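/- Let e, f ∈ ℝ³ be unit vectors, c ∈ (−1, 1), σ, λ₂, μ₁, μ₂ ∈ ℝ, and let m₁, m₃, m₄, m₅, M ∈ ℝ³. Put G := m₁ + σ·e. Consider the pentapod with platform points m₁, m₂ = m₁ + λ₂·e, m₃, m₄, m₅, base points M₁ = M + μ₁·f, M₂ = M + μ₂·f and M₃ = M₄ = M₅ = M (so M₁, M₂ and M₃ = M₄ = M₅ are collinear), and leg lengths R₁ = √(σ² + μ₁² + 2·σ·μ₁·c), R₂ = √((λ₂ − σ)² + μ₂² − 2·(λ₂ − σ)·μ₂·c), and Rⱼ = ‖mⱼ − G‖ for j = 3, 4, 5. Then its configuration set contains the image of an injective continuous map from the open unit ball of ℝ²; i.e., the pentapod has a 2-dimensional spherical self-motion, obtained by placing the point G of the line spanned by m₁ and m₂ at M₃ = M₄ = M₅. (This is the new side-result case (α) of Section 5.1 of the paper.) -/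

import Mathlib

open Metric

noncomputable section

local notation "E2" => EuclideanSpace ℝ (Fin 2)
local notation "E3" => EuclideanSpace ℝ (Fin 3)

/-- A pose of the rigid body, acting by `x ↦ Q·x + t`. -/
abbrev Pose := Matrix (Fin 3) (Fin 3) ℝ × EuclideanSpace ℝ (Fin 3)

/-- Configuration set of a pentapod with platform points `m`, base points `M`
and leg lengths `R`. -/
def pentapodConfig (m M : Fin 5 → EuclideanSpace ℝ (Fin 3)) (R : Fin 5 → ℝ) :
    Set Pose :=
  {p | p.1 ∈ Matrix.specialOrthogonalGroup (Fin 3) ℝ ∧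
    ∀ i : Fin 5, ‖Matrix.toEuclideanLin p.1 (m i) + p.2 - M i‖ = R i}

/-- The configuration set contains the image of an injective continuous map
from the open unit ball of `ℝ²`: a 2-dimensional self-motion. -/
def HasTwoDimSelfMotion (K : Set Pose) : Prop :=
  ∃ φ : EuclideanSpace ℝ (Fin 2) → Pose,
    ContinuousOn φ (Metric.ball 0 1) ∧ Set.InjOn φ (Metric.ball 0 1) ∧
    ∀ x ∈ Metric.ball (0 : EuclideanSpace ℝ (Fin 2)) 1, φ x ∈ K


open Matrix in
theorem so3_iff (A : Matrix (Fin 3) (Fin 3) ℝ) :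
    A ∈ Matrix.specialOrthogonalGroup (Fin 3) ℝ ↔ A * Aᵀ = 1 ∧ A.det = 1 := by
  rw [Matrix.mem_specialOrthogonalGroup_iff, Matrix.mem_orthogonalGroup_iff]

open Matrix in
theorem exists_so3 (f : E3) (hf : ‖f‖ = 1) :
    ∃ A : Matrix (Fin 3) (Fin 3) ℝ, A * Aᵀ = 1 ∧ A.det = 1 ∧ A *ᵥ ![0, 0, 1] = f.ofLp := by
  have h1 : f 0 ^ 2 + f 1 ^ 2 + f 2 ^ 2 = 1 := by
    have := EuclideanSpace.real_norm_sq_eq f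
    rw [hf, Fin.sum_univ_three] at this
    linarith
  have hfv : f.ofLp = ![f 0, f 1, f 2] := by
    ext i; fin_cases i <;> rfl
  rw [hfv]
  generalize f 0 = x at *
  generalize f 1 = y at *
  generalize f 2 = z at *
  by_cases h0 : x ^ 2 + y ^ 2 = 0
  · have hx : x = 0 := by nlinarith [sq_nonneg x, sq_nonneg y]
    have hy : y = 0 := by nlinarith [sq_nonneg x, sq_nonneg y]
    subst hx hy
    have hz : z * z = 1 := by nlinarith
    refine ⟨!![1, 0, 0; 0, z, 0; 0, 0, z], ?_, ?_, ?_⟩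
    · ext i j; fin_cases i <;> fin_cases j <;> simp [Matrix.mul_apply, Fin.sum_univ_three, hz]
    · simp [Matrix.det_fin_three, hz]
    · ext i; fin_cases i <;> simp [Matrix.mulVec, dotProduct, Fin.sum_univ_three]
  · obtain ⟨r, hr, hrr⟩ : ∃ r : ℝ, r ≠ 0 ∧ r ^ 2 = x ^ 2 + y ^ 2 :=
      ⟨√(x ^ 2 + y ^ 2), by
        rw [Real.sqrt_ne_zero']
        exact lt_of_le_of_ne (by positivity) (Ne.symm h0), Real.sq_sqrt (by positivity)⟩
    obtain ⟨a, rfl⟩ : ∃ a, x = r * a := ⟨x / r, by field_simp⟩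
    obtain ⟨b, rfl⟩ : ∃ b, y = r * b := ⟨y / r, by field_simp⟩
    have hab : a ^ 2 + b ^ 2 = 1 := by
      have : r ^ 2 * (a ^ 2 + b ^ 2) = r ^ 2 * 1 := by linarith
      exact mul_left_cancel₀ (pow_ne_zero 2 hr) this
    have hrz : r ^ 2 + z ^ 2 = 1 := by linarith
    clear h1 h0 hrr hfv hr
    refine ⟨!![-b, -z * a, r * a; a, -z * b, r * b; 0, r, z], ?_, ?_, ?_⟩
    · ext i j
      fin_cases i <;> fin_cases j <;>
        simp [Matrix.mul_apply, Fin.sum_univ_three] <;> grind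
    · simp [Matrix.det_fin_three]; grind
    · ext i; fin_cases i <;> simp [Matrix.mulVec, dotProduct, Fin.sum_univ_three]

/-- rotation about the third axis with sine `x` -/
def rotZ (x : ℝ) : Matrix (Fin 3) (Fin 3) ℝ :=
  !![√(1 - x ^ 2), -x, 0; x, √(1 - x ^ 2), 0; 0, 0, 1]

/-- rotation about the first axis -/
def rotX (c s : ℝ) : Matrix (Fin 3) (Fin 3) ℝ :=
  !![1, 0, 0; 0, c, -s; 0, s, c]

theorem rotZ_mem (x : ℝ) (hx : x ^ 2 ≤ 1) :
    rotZ x ∈ Matrix.specialOrthogonalGroup (Fin 3) ℝ := by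
  have h : √(1 - x ^ 2) ^ 2 = 1 - x ^ 2 := Real.sq_sqrt (by linarith)
  rw [so3_iff]
  unfold rotZ
  generalize √(1 - x ^ 2) = y at *
  refine ⟨?_, ?_⟩
  · ext i j
    fin_cases i <;> fin_cases j <;>
        simp [Matrix.mul_apply, Fin.sum_univ_three] <;> grind
  · simp [Matrix.det_fin_three]; grind

theorem rotX_mem (c s : ℝ) (h : c ^ 2 + s ^ 2 = 1) :
    rotX c s ∈ Matrix.specialOrthogonalGroup (Fin 3) ℝ := by
  rw [so3_iff]
  unfold rotX
  refine ⟨?_, ?_⟩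
  · ext i j
    fin_cases i <;> fin_cases j <;>
        simp [Matrix.mul_apply, Fin.sum_univ_three] <;> grind
  · simp [Matrix.det_fin_three]; grind

theorem rotZ_continuous : Continuous rotZ := by
  unfold rotZ
  refine continuous_matrix ?_
  intro i j
  fin_cases i <;> fin_cases j <;> simp <;> fun_prop

def midRot (c s x y : ℝ) : Matrix (Fin 3) (Fin 3) ℝ := rotZ x * rotX c s * rotZ y

theorem midRot_02 (c s x y : ℝ) : midRot c s x y 0 2 = x * s := by
  simp [midRot, rotZ, rotX, Matrix.mul_apply, Fin.sum_univ_three]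

theorem midRot_20 (c s x y : ℝ) : midRot c s x y 2 0 = s * y := by
  simp [midRot, rotZ, rotX, Matrix.mul_apply, Fin.sum_univ_three]

theorem midRot_22 (c s x y : ℝ) : midRot c s x y 2 2 = c := by
  simp [midRot, rotZ, rotX, Matrix.mul_apply, Fin.sum_univ_three]

open Matrix in
theorem so3_inner (A : Matrix (Fin 3) (Fin 3) ℝ) (hA : Aᵀ * A = 1) (u v : E3) :
    inner ℝ (Matrix.toEuclideanLin A u) (Matrix.toEuclideanLin A v) = inner ℝ u v := by
  simp only [EuclideanSpace.inner_eq_star_dotProduct, star_trivial,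
    Matrix.ofLp_toEuclideanLin_apply]
  rw [Matrix.dotProduct_mulVec, Matrix.vecMul_mulVec, hA, Matrix.vecMul_one]

theorem so3_norm (A : Matrix (Fin 3) (Fin 3) ℝ)
    (hA : A ∈ Matrix.specialOrthogonalGroup (Fin 3) ℝ) (u : E3) :
    ‖Matrix.toEuclideanLin A u‖ = ‖u‖ := by
  rw [@norm_eq_sqrt_real_inner E3, @norm_eq_sqrt_real_inner E3,
    so3_inner A (mul_eq_one_comm.1 ((so3_iff A).1 hA).1)]

theorem norm_comb (u f : E3) (hu : ‖u‖ = 1) (hf : ‖f‖ = 1) (c : ℝ) (h : inner ℝ u f = c)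
    (a b : ℝ) : ‖a • u - b • f‖ = √(a ^ 2 + b ^ 2 - 2 * a * b * c) := by
  rw [← Real.sqrt_sq (norm_nonneg (a • u - b • f)), norm_sub_sq_real, norm_smul, norm_smul,
    real_inner_smul_left, real_inner_smul_right, hu, hf, h]
  congr 1
  simp only [Real.norm_eq_abs, mul_one, sq_abs]
  ring

/-- Case (α) of Section 5.1: a pentapod with `M₃ = M₄ = M₅ = M`, collinear base
points `M₁, M₂, M` and the stated leg lengths has a 2-dimensional spherical
self-motion, obtained by placing the point `G = m₁ + σ·e` of the line spanned
by `m₁, m₂` at `M`. -/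
theorem pentapod_case_alpha
    (e f : E3) (he : ‖e‖ = 1) (hf : ‖f‖ = 1)
    (c : ℝ) (hc : c ∈ Set.Ioo (-1 : ℝ) 1)
    (sig lam₂ mu₁ mu₂ : ℝ) (m₁ m₃ m₄ m₅ M : E3)
    (G : E3) (hG : G = m₁ + sig • e) :
    HasTwoDimSelfMotion
      (pentapodConfig
        ![m₁, m₁ + lam₂ • e, m₃, m₄, m₅]
        ![M + mu₁ • f, M + mu₂ • f, M, M, M]
        ![Real.sqrt (sig ^ 2 + mu₁ ^ 2 + 2 * sig * mu₁ * c),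
          Real.sqrt ((lam₂ - sig) ^ 2 + mu₂ ^ 2 - 2 * (lam₂ - sig) * mu₂ * c),
          ‖m₃ - G‖, ‖m₄ - G‖, ‖m₅ - G‖]) := by
  obtain ⟨A, hA, hAd, hAe⟩ := exists_so3 e he
  obtain ⟨B, hB, hBd, hBf⟩ := exists_so3 f hf
  obtain ⟨s, hs, hcs⟩ : ∃ s : ℝ, s ≠ 0 ∧ c ^ 2 + s ^ 2 = 1 := by
    have h : 0 < 1 - c ^ 2 := by nlinarith [hc.1, hc.2]
    exact ⟨√(1 - c ^ 2), (Real.sqrt_pos.2 h).ne', by rw [Real.sq_sqrt h.le]; ring⟩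
  have hA' := mul_eq_one_comm.1 hA
  have hB' := mul_eq_one_comm.1 hB
  have hAm : A.transpose ∈ Matrix.specialOrthogonalGroup (Fin 3) ℝ := by
    rw [so3_iff]; simp [hA', hAd]
  have hBm : B ∈ Matrix.specialOrthogonalGroup (Fin 3) ℝ := by
    rw [so3_iff]; exact ⟨hB, hBd⟩
  let Q : E2 → Matrix (Fin 3) (Fin 3) ℝ := fun x => B * midRot c s (x 0) (x 1) * A.transpose
  have hQc : Continuous Q := by
    have h0 : Continuous fun x : E2 => rotZ (x 0) := rotZ_continuous.comp (by fun_prop)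
    have h1 : Continuous fun x : E2 => rotZ (x 1) := rotZ_continuous.comp (by fun_prop)
    exact (continuous_const.mul ((h0.mul continuous_const).mul h1)).mul continuous_const
  have hQ : ∀ x ∈ Metric.ball (0 : E2) 1, Q x ∈ Matrix.specialOrthogonalGroup (Fin 3) ℝ := by
    intro x hx
    have h1 : ‖x‖ < 1 := by simpa using hx
    have h2 := EuclideanSpace.real_norm_sq_eq x
    rw [Fin.sum_univ_two] at h2
    have h3 : ‖x‖ ^ 2 ≤ 1 := by nlinarith [norm_nonneg x]
    refine mul_mem (mul_mem hBm (mul_mem (mul_mem (rotZ_mem _ ?_) (rotX_mem _ _ hcs))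
      (rotZ_mem _ ?_))) hAm
    · nlinarith [sq_nonneg (x 1)]
    · nlinarith [sq_nonneg (x 0)]
  have hQi : ∀ x, inner ℝ (Matrix.toEuclideanLin (Q x) e) f = c := by
    intro x
    simp only [EuclideanSpace.inner_eq_star_dotProduct, star_trivial,
      Matrix.ofLp_toEuclideanLin_apply]
    rw [← hAe, ← hBf, Matrix.mulVec_mulVec, Matrix.mul_assoc, hA', Matrix.mul_one,
      ← Matrix.mulVec_mulVec, Matrix.dotProduct_mulVec, Matrix.vecMul_mulVec, hB',
      Matrix.vecMul_one]
    simp [Matrix.mulVec, dotProduct, Fin.sum_univ_three, midRot_22]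
  refine ⟨fun x => (Q x, M - Matrix.toEuclideanLin (Q x) G), ?_, ?_, ?_⟩
  · apply Continuous.continuousOn
    refine hQc.prodMk (continuous_const.sub ?_)
    simp only [Matrix.toEuclideanLin_apply]
    exact (PiLp.continuous_toLp 2 _).comp (hQc.matrix_mulVec continuous_const)
  · intro x _ y _ hxy
    have h1 : B * midRot c s (x 0) (x 1) * A.transpose
      = B * midRot c s (y 0) (y 1) * A.transpose := congrArg Prod.fst hxy
    have h2 : midRot c s (x 0) (x 1) = midRot c s (y 0) (y 1) := by
      have h3 := congrArg (fun X => B.transpose * (X * A)) h1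
      simpa only [Matrix.mul_assoc, hA', Matrix.mul_one, ← Matrix.mul_assoc B.transpose B, hB',
        Matrix.one_mul] using h3
    have h4 := congrFun (congrFun h2 0) 2
    have h5 := congrFun (congrFun h2 2) 0
    rw [midRot_02, midRot_02] at h4
    rw [midRot_20, midRot_20] at h5
    ext i
    fin_cases i
    · exact mul_right_cancel₀ hs h4
    · exact mul_left_cancel₀ hs h5
  · intro x hx
    refine ⟨hQ x hx, ?_⟩
    have hu : ‖Matrix.toEuclideanLin (Q x) e‖ = 1 := by rw [so3_norm _ (hQ x hx), he]
    have hpt : ∀ p : E3, ‖Matrix.toEuclideanLin (Q x) p + (M - Matrix.toEuclideanLin (Q x) G) - M‖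
        = ‖p - G‖ := by
      intro p
      rw [← so3_norm _ (hQ x hx) (p - G), map_sub]
      congr 1
      abel
    intro i
    fin_cases i
    · have := norm_comb _ f hu hf c (hQi x) (-sig) mu₁
      have h2 : sig ^ 2 + mu₁ ^ 2 + 2 * sig * mu₁ * c
        = (-sig) ^ 2 + mu₁ ^ 2 - 2 * (-sig) * mu₁ * c := by ring
      simp only [Fin.zero_eta, Matrix.cons_val_zero]
      rw [h2, ← this, hG, map_add, map_smul]
      congr 1
      module
    · have := norm_comb _ f hu hf c (hQi x) (lam₂ - sig) mu₂
      simp only [Fin.mk_one, Matrix.cons_val_one, Matrix.cons_val_zero]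
      rw [← this, hG, map_add, map_add, map_smul, map_smul]
      congr 1
      module
    · exact hpt m₃
    · exact hpt m₄
    · exact hpt m₅

end
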